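/- Let A, B, C be multiplicative characters on F_q with A ≠ ε, B ≠ ε, B ≠ C and A ≠ C, and let x ∈ F_q with x ≠ 1. Then ₂F₁*(A, B; C | x) = (conj(AB)·C)(1-x) · ₂F₁*(CĀ, CB̄; C | x), where conj(AB) denotes the inverse of the character AB. -/

import Mathlib

/-- Multiplicative characters of a finite field with values in `ℂ` form a finite type. -/
noncomputable instance mulCharFintypeC (F : Type*) [Field F] [Fintype F] :
    Fintype (MulChar F ℂ) :=
  Fintype.ofFinite _

/-- The canonical additive character `θ(α) = ζ^{tr(α)}` of a finite field `F` of
characteristic `p`, where `ζ` is a fixed primitive `p`-th root of unity in `ℂ`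
and `tr` is the trace map to `ZMod p = F_p`. -/
noncomputable def addCharTheta (p : ℕ) (F : Type*) [Field F] [Fintype F]
    [Algebra (ZMod p) F] (zeta : ℂ) (a : F) : ℂ :=
  zeta ^ (Algebra.trace (ZMod p) F a).val

/-- The Gauss sum `g(χ) = ∑_{x ∈ F} χ(x) θ(x)`. -/
noncomputable def gaussS (p : ℕ) (F : Type*) [Field F] [Fintype F]
    [Algebra (ZMod p) F] (zeta : ℂ) (χ : MulChar F ℂ) : ℂ :=
  ∑ x : F, χ x * addCharTheta p F zeta x

/-- McCarthy's finite field hypergeometric function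
`₂F₁*(A₀, A₁; B₁ | x) = (1/(q-1)) ∑_χ [g(A₀χ)g(A₁χ)g((B₁χ)⁻¹)g(χ⁻¹)/(g(A₀)g(A₁)g(B₁⁻¹))] χ(x)`. -/
noncomputable def mcCarthy2F1 (p : ℕ) (F : Type*) [Field F] [Fintype F]
    [Algebra (ZMod p) F] (zeta : ℂ) (A₀ A₁ B₁ : MulChar F ℂ) (x : F) : ℂ :=
  (1 / ((Fintype.card F : ℂ) - 1)) * ∑ χ : MulChar F ℂ,
    gaussS p F zeta (A₀ * χ) * gaussS p F zeta (A₁ * χ) * gaussS p F zeta (B₁ * χ)⁻¹ *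
      gaussS p F zeta χ⁻¹ /
        (gaussS p F zeta A₀ * gaussS p F zeta A₁ * gaussS p F zeta B₁⁻¹) * χ x

/-- The finite field Appell function `F₄*(A; B; C, C'; x, y)`. -/
noncomputable def appellF4star (p : ℕ) (F : Type*) [Field F] [Fintype F]
    [Algebra (ZMod p) F] (zeta : ℂ) (A B C C' : MulChar F ℂ) (x y : F) : ℂ :=
  (1 / ((Fintype.card F : ℂ) - 1) ^ 2) * ∑ ψ : MulChar F ℂ, ∑ χ : MulChar F ℂ,
    gaussS p F zeta (A * χ * ψ) * gaussS p F zeta (B * χ * ψ) * gaussS p F zeta (C * ψ)⁻¹ *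
      gaussS p F zeta (C' * χ)⁻¹ * gaussS p F zeta ψ⁻¹ * gaussS p F zeta χ⁻¹ /
        (gaussS p F zeta A * gaussS p F zeta B * gaussS p F zeta C⁻¹ *
          gaussS p F zeta C'⁻¹) *
      (ψ x * χ y)

/-- The finite field Appell function `F₁*(A; B, B'; C; x, y)`. -/
noncomputable def appellF1star (p : ℕ) (F : Type*) [Field F] [Fintype F]
    [Algebra (ZMod p) F] (zeta : ℂ) (A B B' C : MulChar F ℂ) (x y : F) : ℂ :=
  (1 / ((Fintype.card F : ℂ) - 1) ^ 2) * ∑ ψ : MulChar F ℂ, ∑ χ : MulChar F ℂ,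
    gaussS p F zeta (A * χ * ψ) * gaussS p F zeta (B * ψ) * gaussS p F zeta (B' * χ) *
      gaussS p F zeta (C * χ * ψ)⁻¹ * gaussS p F zeta ψ⁻¹ * gaussS p F zeta χ⁻¹ /
        (gaussS p F zeta A * gaussS p F zeta B * gaussS p F zeta B' *
          gaussS p F zeta C⁻¹) *
      (ψ x * χ y)

/-- The Jacobi sum `J(A,B) = ∑_{x ∈ F} A(x) B(1-x)`. -/
noncomputable def jacobiS (F : Type*) [Field F] [Fintype F] (A B : MulChar F ℂ) : ℂ :=
  ∑ x : F, A x * B (1 - x)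

/-- Greene's binomial coefficient `(A choose B) = (B(-1)/q) J(A, B⁻¹)`. -/
noncomputable def binomChar (F : Type*) [Field F] [Fintype F] (A B : MulChar F ℂ) : ℂ :=
  (B (-1) / (Fintype.card F : ℂ)) * jacobiS F A B⁻¹

/-- Orthogonality of multiplicative characters: the sum over all characters detects `1`. -/
theorem sum_mulChar_apply {F : Type*} [Field F] [Fintype F] [DecidableEq F] (a : F) :
    ∑ χ : MulChar F ℂ, χ a = if a = 1 then (Fintype.card F : ℂ) - 1 else 0 := by
  split_ifs with h
  · subst h
    have hcard : Fintype.card (MulChar F ℂ) = Fintype.card F - 1 := by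
      rw [← Nat.card_eq_fintype_card, MulChar.card_eq_card_units_of_hasEnoughRootsOfUnity,
        Nat.card_eq_fintype_card, Fintype.card_units]
    simp [hcard, Nat.cast_sub Fintype.card_pos]
  · obtain ⟨η, hη⟩ := MulChar.exists_apply_ne_one_of_hasEnoughRootsOfUnity F ℂ h
    have hshift : ∑ χ : MulChar F ℂ, χ a = η a * ∑ χ : MulChar F ℂ, χ a := by
      refine (Equiv.sum_comp (Equiv.mulLeft η) fun χ => χ a).symm.trans ?_
      simp [Finset.mul_sum]
    have hzero : (η a - 1) * ∑ χ : MulChar F ℂ, χ a = 0 := by linear_combination -hshift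
    exact (mul_eq_zero.mp hzero).resolve_left (sub_ne_zero.mpr hη)

theorem MulChar.map_inv_of_field {F R : Type*} [Field F] [Field R] (χ : MulChar F R) (a : F) :
    χ a⁻¹ = (χ a)⁻¹ := by
  rw [← MulChar.inv_apply', MulChar.inv_apply_eq_inv']

section GaussSum

variable {F R : Type*} [Field F] [Fintype F] [Field R]

/-- The scaled Gauss sum of a nontrivial character, including the scaling factor `0`. -/
theorem sum_mulChar_mul_addChar_mul {χ : MulChar F R} (hχ : χ ≠ 1) (ψ : AddChar F R) (c : F) :
    ∑ v, χ v * ψ (c * v) = χ⁻¹ c * gaussSum χ ψ := by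
  by_cases hc : c = 0
  · subst hc
    simp [MulChar.sum_eq_zero_of_ne_one hχ, MulChar.map_zero]
  · have h := gaussSum_mulShift_eq χ ψ (Units.mk0 c hc)
    simpa [gaussSum, AddChar.mulShift_apply] using h

theorem gaussSum_mul_gaussSum_eq_sum {α β : MulChar F R} (h : α * β ≠ 1) (ψ : AddChar F R) :
    gaussSum α ψ * gaussSum β ψ =
      gaussSum (α * β) ψ * ∑ t, α t * (α * β)⁻¹ (1 + t) := by
  have hscale (v : F) : ∑ u, α u * ψ u * (β v * ψ v) =
      ∑ t, α t * ((α * β) v * ψ ((1 + t) * v)) := by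
    by_cases hv : v = 0
    · simp [hv, MulChar.map_zero]
    · rw [← Equiv.sum_comp (Equiv.mulRight₀ v hv)]
      refine Finset.sum_congr rfl fun t _ => ?_
      simp only [Equiv.mulRight₀_apply, map_mul, MulChar.mul_apply]
      rw [show (1 + t) * v = t * v + v by ring, AddChar.map_add_eq_mul]
      ring
  calc gaussSum α ψ * gaussSum β ψ
      = ∑ v, ∑ u, α u * ψ u * (β v * ψ v) := by
        rw [gaussSum, gaussSum, Finset.sum_mul_sum, Finset.sum_comm]
    _ = ∑ t, α t * ∑ v, (α * β) v * ψ ((1 + t) * v) := by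
        simp_rw [hscale, Finset.mul_sum]
        exact Finset.sum_comm
    _ = _ := by
        simp_rw [sum_mulChar_mul_addChar_mul h, Finset.mul_sum]
        exact Finset.sum_congr rfl fun t _ => by ring

theorem gaussSum_mul_gaussSum_inv {χ : MulChar F R} (hχ : χ ≠ 1) {ψ : AddChar F R}
    (hψ : ψ.IsPrimitive) :
    gaussSum χ ψ * gaussSum χ⁻¹ ψ = χ (-1) * Fintype.card F := by
  have h := gaussSum_mul_gaussSum_eq_card hχ hψ
  have h' := mul_gaussSum_inv_eq_gaussSum χ⁻¹ ψ
  have hneg : χ⁻¹ (-1) = χ (-1) := by rw [MulChar.inv_apply', inv_neg, inv_one]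
  rw [← h', hneg, ← h]
  ring

end GaussSum

/-- The sum over the field that underlies the integral representation of `₂F₁*`. -/
noncomputable def eulerSum {F : Type*} [Field F] [Fintype F] (A B C : MulChar F ℂ) (x : F) : ℂ :=
  ∑ t, (A * C⁻¹) t * A⁻¹ (1 + t) * (C * B⁻¹) (1 + t * x)

theorem sum_gaussSum_eq_eulerSum {F : Type*} [Field F] [Fintype F] (ψ : AddChar F ℂ)
    {A B C : MulChar F ℂ} (hA : A ≠ 1) (hBC : B ≠ C) {x : F} (hx : x ≠ 0) :
    ∑ χ : MulChar F ℂ, gaussSum (A * χ) ψ * gaussSum (B * χ) ψ * gaussSum (C * χ)⁻¹ ψ *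
        gaussSum χ⁻¹ ψ * χ x =
      ((Fintype.card F : ℂ) - 1) *
        (gaussSum A ψ * gaussSum (B * C⁻¹) ψ * C⁻¹ x * eulerSum A B C x) := by
  classical
  have hBC' : B * C⁻¹ ≠ 1 := fun h => hBC (mul_inv_eq_one.mp h)
  have hAχ (χ : MulChar F ℂ) : gaussSum (A * χ) ψ * gaussSum χ⁻¹ ψ =
      gaussSum A ψ * ∑ t, A t * χ t * A⁻¹ (1 + t) := by
    have h : A * χ * χ⁻¹ = A := mul_inv_cancel_right A χ
    rw [gaussSum_mul_gaussSum_eq_sum (by rwa [h]), h]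
    rfl
  have hBχ (χ : MulChar F ℂ) : gaussSum (B * χ) ψ * gaussSum (C * χ)⁻¹ ψ =
      gaussSum (B * C⁻¹) ψ * ∑ s, B s * χ s * (B * C⁻¹)⁻¹ (1 + s) := by
    have h : B * χ * (C * χ)⁻¹ = B * C⁻¹ := by
      rw [mul_inv, mul_mul_mul_comm, mul_inv_cancel, mul_one]
    rw [gaussSum_mul_gaussSum_eq_sum (by rwa [h]), h]
    rfl
  calc _ = gaussSum A ψ * gaussSum (B * C⁻¹) ψ * ∑ t, ∑ s,
        A t * A⁻¹ (1 + t) * (B s * (B * C⁻¹)⁻¹ (1 + s)) * ∑ χ : MulChar F ℂ, χ (t * s * x) := by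
        simp_rw [Finset.mul_sum]
        rw [Finset.sum_congr rfl fun t _ => Finset.sum_comm, Finset.sum_comm]
        refine Finset.sum_congr rfl fun χ _ => ?_
        rw [show gaussSum (A * χ) ψ * gaussSum (B * χ) ψ * gaussSum (C * χ)⁻¹ ψ *
          gaussSum χ⁻¹ ψ * χ x = (gaussSum (A * χ) ψ * gaussSum χ⁻¹ ψ) *
            (gaussSum (B * χ) ψ * gaussSum (C * χ)⁻¹ ψ) * χ x by ring, hAχ, hBχ,
          mul_mul_mul_comm, Finset.sum_mul_sum, mul_assoc, Finset.sum_mul, Finset.mul_sum]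
        refine Finset.sum_congr rfl fun t _ => ?_
        rw [Finset.sum_mul, Finset.mul_sum]
        refine Finset.sum_congr rfl fun s _ => ?_
        rw [map_mul, map_mul]
        ring
    _ = _ := by
        simp_rw [eulerSum, sum_mulChar_apply, Finset.mul_sum]
        refine Finset.sum_congr rfl fun t _ => ?_
        by_cases ht : t = 0
        · simp [ht, MulChar.map_zero]
        have htx : t * x ≠ 0 := mul_ne_zero ht hx
        have hiff (s : F) : t * s * x = 1 ↔ s = (t * x)⁻¹ := by
          rw [← mul_eq_one_iff_eq_inv₀ htx, mul_right_comm, mul_comm]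
        have hBt : B t ≠ 0 := MulChar.apply_ne_zero_iff.mpr (isUnit_iff_ne_zero.mpr ht)
        have hBx : B x ≠ 0 := MulChar.apply_ne_zero_iff.mpr (isUnit_iff_ne_zero.mpr hx)
        have hinv : 1 + (t * x)⁻¹ = (1 + t * x) * (t * x)⁻¹ := by
          rw [add_mul, one_mul, mul_inv_cancel₀ htx, add_comm]
        simp_rw [hiff, mul_ite, mul_zero]
        rw [Finset.sum_ite_eq' Finset.univ, if_pos (Finset.mem_univ _), hinv]
        simp only [map_mul, MulChar.map_inv_of_field, mul_inv, inv_inv, MulChar.mul_apply,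
          MulChar.inv_apply_eq_inv']
        field_simp

/-- Euler's transformation for the underlying sum, by the involution of the projective line that
exchanges `0` with `-1` and `-1 / x` with `∞`. -/
theorem eulerSum_eq {F : Type*} [Field F] [Fintype F] (A B C : MulChar F ℂ) {x : F} (hx : x ≠ 1) :
    eulerSum A B C x =
      C (-1) * ((A * B)⁻¹ * C) (1 - x) * eulerSum (C * A⁻¹) (C * B⁻¹) C x := by
  classical
  have hx1 : 1 - x ≠ 0 := sub_ne_zero.mpr hx.symm
  set σ : F → F := fun u => if 1 + u * x = 0 then u else -(1 + u) / (1 + u * x) with hσ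
  have hσx (u : F) (hu : 1 + u * x ≠ 0) : 1 + σ u * x = (1 - x) / (1 + u * x) := by
    simp only [hσ, if_neg hu]
    field_simp
    ring
  have hσ1 (u : F) (hu : 1 + u * x ≠ 0) : 1 + σ u = (-1) * (u * (1 - x)) / (1 + u * x) := by
    simp only [hσ, if_neg hu]
    field_simp
    ring
  have hinv : Function.Involutive σ := by
    intro u
    by_cases hu : 1 + u * x = 0
    · simp [hσ, hu]
    · have h : 1 + σ u * x ≠ 0 := by
        rw [hσx u hu]
        exact div_ne_zero hx1 hu
      have heq : σ (σ u) = -(1 + σ u) / (1 + σ u * x) := if_neg h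
      rw [heq, hσ1 u hu, hσx u hu]
      field_simp
  rw [eulerSum, eulerSum, ← Equiv.sum_comp hinv.toPerm, Finset.mul_sum]
  refine Finset.sum_congr rfl fun u _ => ?_
  rw [Function.Involutive.coe_toPerm]
  by_cases hu : 1 + u * x = 0
  · have hσu : σ u = u := if_pos hu
    simp [hσu, hu, MulChar.map_zero]
  · rw [hσx u hu, hσ1 u hu]
    have hσu : σ u = (-1) * (1 + u) / (1 + u * x) := by simp [hσ, hu]
    have hne (χ : MulChar F ℂ) {a : F} (ha : a ≠ 0) : χ a ≠ 0 :=
      MulChar.apply_ne_zero_iff.mpr (isUnit_iff_ne_zero.mpr ha)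
    have hA := hne A hu
    have hB := hne B hu
    have hC := hne C hu
    have hA1 := hne A hx1
    have hB1 := hne B hx1
    have hC1 := hne C hx1
    have hAm := hne A (neg_ne_zero.mpr one_ne_zero)
    have hCm := hne C (neg_ne_zero.mpr one_ne_zero)
    have hCsq : C (-1) * C (-1) = 1 := by rw [← map_mul]; simp
    have hCinv : (C (-1))⁻¹ = C (-1) := inv_eq_of_mul_eq_one_left hCsq
    rw [hσu]
    simp only [div_eq_mul_inv, map_mul, MulChar.map_inv_of_field, mul_inv, inv_inv,
      MulChar.mul_apply, MulChar.inv_apply_eq_inv', hCinv]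
    by_cases hCu : C u = 0
    · have : u = 0 := by
        by_contra h
        exact hne C h hCu
      simp [this, MulChar.map_zero]
    field_simp

/-- The function `addCharTheta` as an additive character. -/
noncomputable def thetaChar (p : ℕ) [Fact p.Prime] (F : Type*) [Field F]
    [Algebra (ZMod p) F] {zeta : ℂ} (hzeta : IsPrimitiveRoot zeta p) : AddChar F ℂ :=
  (AddChar.zmodChar p hzeta.pow_eq_one).compAddMonoidHom
    (Algebra.trace (ZMod p) F).toAddMonoidHom

theorem gaussS_eq_gaussSum (p : ℕ) [Fact p.Prime] (F : Type*) [Field F] [Fintype F]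
    [Algebra (ZMod p) F] {zeta : ℂ} (hzeta : IsPrimitiveRoot zeta p) (χ : MulChar F ℂ) :
    gaussS p F zeta χ = gaussSum χ (thetaChar p F hzeta) := rfl

theorem thetaChar_isPrimitive (p : ℕ) [Fact p.Prime] (F : Type*) [Field F] [Fintype F]
    [Algebra (ZMod p) F] {zeta : ℂ} (hzeta : IsPrimitiveRoot zeta p) :
    (thetaChar p F hzeta).IsPrimitive := by
  refine AddChar.IsPrimitive.of_ne_one ?_
  obtain ⟨a, ha⟩ := Algebra.trace_surjective (ZMod p) F 1
  refine AddChar.ne_one_iff.mpr ⟨a, ?_⟩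
  have : thetaChar p F hzeta a = zeta ^ (Algebra.trace (ZMod p) F a).val := rfl
  rw [this, ha, ZMod.val_one, pow_one]
  exact hzeta.ne_one (Fact.out : p.Prime).one_lt

theorem stmt9    (p : ℕ) [Fact p.Prime] (hp : p ≠ 2) (F : Type*) [Field F] [Fintype F]
    [Algebra (ZMod p) F] (zeta : ℂ) (hzeta : IsPrimitiveRoot zeta p)
    (A B C : MulChar F ℂ) (hA : A ≠ 1) (hB : B ≠ 1) (hBC : B ≠ C) (hAC : A ≠ C)
    (x : F) (hx : x ≠ 1) :
    mcCarthy2F1 p F zeta A B C x =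
    ((A * B)⁻¹ * C) (1 - x) * mcCarthy2F1 p F zeta (C * A⁻¹) (C * B⁻¹) C x := by
  by_cases hx0 : x = 0
  · simp [hx0, mcCarthy2F1, MulChar.map_zero]
  have hq : (Fintype.card F : ℂ) - 1 ≠ 0 :=
    sub_ne_zero.mpr (by exact_mod_cast Fintype.one_lt_card.ne')
  have hcard : (Fintype.card F : ℂ) ≠ 0 := by exact_mod_cast Fintype.card_ne_zero
  have hψ := thetaChar_isPrimitive p F hzeta
  have hCA : C * A⁻¹ ≠ 1 := fun h => hAC (mul_inv_eq_one.mp h).symm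
  have hCB : C * B⁻¹ ≠ 1 := fun h => hBC (mul_inv_eq_one.mp h).symm
  have hCBC : C * B⁻¹ ≠ C := by simpa using hB
  have hgauss {χ : MulChar F ℂ} (hχ : χ ≠ 1) : gaussSum χ (thetaChar p F hzeta) ≠ 0 :=
    gaussSum_ne_zero_of_nontrivial hcard hχ hψ
  have hCBB : C * B⁻¹ * C⁻¹ = B⁻¹ := by rw [mul_right_comm, mul_inv_cancel, one_mul]
  have hratio := gaussSum_mul_gaussSum_inv hCB hψ
  have hratio' := gaussSum_mul_gaussSum_inv hB hψ
  rw [mul_inv, inv_inv, mul_comm C⁻¹ B] at hratio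
  simp only [mcCarthy2F1, gaussS_eq_gaussSum p F hzeta, div_mul_eq_mul_div, ← Finset.sum_div]
  rw [sum_gaussSum_eq_eulerSum _ hA hBC hx0, sum_gaussSum_eq_eulerSum _ hCA hCBC hx0,
    eulerSum_eq A B C hx, hCBB]
  have hkey : C (-1) * gaussSum (B * C⁻¹) (thetaChar p F hzeta) *
      gaussSum (C * B⁻¹) (thetaChar p F hzeta) =
        gaussSum B (thetaChar p F hzeta) * gaussSum B⁻¹ (thetaChar p F hzeta) := by
    have hCsq : C (-1) * C (-1) = 1 := by rw [← map_mul]; simp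
    rw [MulChar.mul_apply, MulChar.inv_apply', inv_neg, inv_one] at hratio
    rw [hratio']
    linear_combination C (-1) * hratio + B (-1) * Fintype.card F * hCsq
  have hgA := hgauss hA
  have hgB := hgauss hB
  have hgCA := hgauss hCA
  have hgCB := hgauss hCB
  field_simp
  linear_combination (C⁻¹ x * ((A * B)⁻¹ * C) (1 - x) * eulerSum (C * A⁻¹) (C * B⁻¹) C x *
    (gaussSum C⁻¹ (thetaChar p F hzeta))⁻¹) * hkey
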